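/- Let Γ₁ = ℤ + ℤω ⊂ ℂ with ω = exp(2πi/3), let u = exp(πi/3), and let Φ : Γ₁³ → Γ₁³ be the additive group homomorphism Φ(z₁,z₂,z₃) = (uz₁ − z₁, uz₂ − uz₁ − z₂, exp(−2πi/3)·z₃ − z₃) (well defined since uΓ₁ = Γ₁). Then the quotient group Γ₁³ / Φ(Γ₁³) is isomorphic to ℤ/3ℤ. -/

import Mathlib

/-- The primitive cube root of unity `ω = exp(2πi/3)`. -/
noncomputable def ω₀ : ℂ := Complex.exp (2 * Real.pi * Complex.I / 3)

/-- The primitive sixth root of unity `u = exp(πi/3)`. -/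
noncomputable def u₀ : ℂ := Complex.exp (Real.pi * Complex.I / 3)

/-- The Eisenstein lattice `Γ₁ = ℤ + ℤω ⊂ ℂ`. -/
noncomputable def Γ₁ : AddSubgroup ℂ := AddSubgroup.closure {1, ω₀}

theorem aux_omega_im : ω₀.im ≠ 0 := by
  have h : (2 * Real.pi * Complex.I / 3 : ℂ) = ((2 * Real.pi / 3 : ℝ) : ℂ) * Complex.I := by
    push_cast; ring
  rw [ω₀, h, Complex.exp_ofReal_mul_I_im]
  apply ne_of_gt
  apply Real.sin_pos_of_pos_of_lt_pi <;> linarith [Real.pi_pos]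

theorem aux_omega_sq : ω₀ ^ 2 = -1 - ω₀ := by
  have h3 : ω₀ ^ 3 = 1 := by
    rw [ω₀, ← Complex.exp_nat_mul, ← Complex.exp_two_pi_mul_I]
    congr 1
    push_cast; ring
  have hne : ω₀ - 1 ≠ 0 := by
    intro h
    apply aux_omega_im
    rw [sub_eq_zero.mp h]; simp
  apply mul_left_cancel₀ hne
  linear_combination h3

theorem aux_u : u₀ = 1 + ω₀ := by
  have h : u₀ * ω₀ = -1 := by
    rw [u₀, ω₀, ← Complex.exp_add, ← Complex.exp_pi_mul_I]
    congr 1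
    ring
  linear_combination (-1 - ω₀) * h + u₀ * aux_omega_sq

theorem aux_exp : Complex.exp (-(2 * Real.pi * Complex.I) / 3) = -1 - ω₀ := by
  have h : Complex.exp (-(2 * Real.pi * Complex.I) / 3) * ω₀ = 1 := by
    rw [ω₀, ← Complex.exp_add, ← Complex.exp_zero]
    congr 1
    ring
  linear_combination (-1 - ω₀) * h + Complex.exp (-(2 * Real.pi * Complex.I) / 3) * aux_omega_sq

theorem aux_mem (z : ℂ) : z ∈ Γ₁ ↔ ∃ p : ℤ × ℤ, (p.1 : ℂ) + p.2 * ω₀ = z := by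
  rw [Γ₁, AddSubgroup.mem_closure_pair]
  simp [Prod.exists]

theorem aux_inj (p q : ℤ × ℤ) (h : (p.1 : ℂ) + p.2 * ω₀ = q.1 + q.2 * ω₀) : p = q := by
  have h2 : p.2 = q.2 := by
    have := congrArg Complex.im h
    simp at this
    rcases this with h | h
    · exact h
    · exact absurd h aux_omega_im
  rw [h2] at h
  have h1 : p.1 = q.1 := by simpa using h
  exact Prod.ext h1 h2

theorem aux_omega_mul (z : ℂ) (hz : z ∈ Γ₁) : ω₀ * z ∈ Γ₁ := by
  rw [aux_mem] at hz ⊢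
  obtain ⟨p, rfl⟩ := hz
  refine ⟨(-p.2, p.1 - p.2), ?_⟩
  push_cast
  linear_combination (-p.2 : ℂ) * aux_omega_sq

/-- If `Φ : Γ₁³ → Γ₁³` is the additive homomorphism
`Φ(z₁,z₂,z₃) = (uz₁ − z₁, uz₂ − uz₁ − z₂, exp(−2πi/3)z₃ − z₃)`, then
`Γ₁³ / Φ(Γ₁³) ≅ ℤ/3ℤ`. -/
theorem quotient_by_F16_sub_id (Φ : (Γ₁ × Γ₁ × Γ₁) →+ (Γ₁ × Γ₁ × Γ₁))
    (hΦ : ∀ z : Γ₁ × Γ₁ × Γ₁,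
      ((Φ z).1 : ℂ) = u₀ * (z.1 : ℂ) - (z.1 : ℂ) ∧
      ((Φ z).2.1 : ℂ) = u₀ * (z.2.1 : ℂ) - u₀ * (z.1 : ℂ) - (z.2.1 : ℂ) ∧
      ((Φ z).2.2 : ℂ) = Complex.exp (-(2 * Real.pi * Complex.I) / 3) * (z.2.2 : ℂ)
        - (z.2.2 : ℂ)) :
    Nonempty (((Γ₁ × Γ₁ × Γ₁) ⧸ Φ.range) ≃+ ZMod 3) := by
  have hex : ∀ z : Γ₁, ∃ p : ℤ × ℤ, (p.1 : ℂ) + p.2 * ω₀ = z := fun z => (aux_mem z).1 z.2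
  choose c hc using hex
  have hcu : ∀ (z : Γ₁) (a b : ℤ), (z : ℂ) = a + b * ω₀ → c z = (a, b) := by
    intro z a b h
    apply aux_inj
    rw [hc, h]
  have hadd : ∀ z w : Γ₁, c (z + w) = ((c z).1 + (c w).1, (c z).2 + (c w).2) := by
    intro z w
    apply hcu
    push_cast
    rw [← hc z, ← hc w]
    ring
  let g : (Γ₁ × Γ₁ × Γ₁) →+ ZMod 3 :=
    AddMonoidHom.mk' (fun z => (((c z.2.2).1 + (c z.2.2).2 : ℤ) : ZMod 3)) (by
      intro z w
      simp only [Prod.snd_add, hadd]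
      push_cast
      ring)
  have hg : ∀ z, g z = (((c z.2.2).1 + (c z.2.2).2 : ℤ) : ZMod 3) := fun z => rfl
  have hsurj : Function.Surjective g := by
    intro t
    obtain ⟨n, rfl⟩ := ZMod.intCast_surjective t
    refine ⟨(0, 0, ⟨(n : ℂ), (aux_mem _).2 ⟨(n, 0), by simp⟩⟩), ?_⟩
    rw [hg, hcu _ n 0 (by simp)]
    simp
  have hker : Φ.range = g.ker := by
    ext w
    rw [AddMonoidHom.mem_ker, hg, ZMod.intCast_zmod_eq_zero_iff_dvd]
    constructor
    · rintro ⟨z, rfl⟩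
      have h := (hΦ z).2.2
      rw [aux_exp, ← hc z.2.2] at h
      rw [hcu _ (-2 * (c z.2.2).1 + (c z.2.2).2) (-(c z.2.2).1 - (c z.2.2).2) (by
        rw [h]
        push_cast
        linear_combination (-(c z.2.2).2 : ℂ) * aux_omega_sq)]
      exact ⟨-(c z.2.2).1, by push_cast; ring⟩
    · rintro ⟨k, hk⟩
      have hk' : ((c w.2.2).1 : ℂ) + (c w.2.2).2 = 3 * k := by exact_mod_cast hk
      have m1 : ω₀ * (ω₀ * (w.1 : ℂ)) ∈ Γ₁ := aux_omega_mul _ (aux_omega_mul _ w.1.2)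
      have m3 : ω₀ * (ω₀ * ((w.2.1 : ℂ) + (ω₀ * (ω₀ * (w.1 : ℂ)) + ω₀ * (ω₀ * (ω₀ * (w.1 : ℂ)))))) ∈ Γ₁ :=
        aux_omega_mul _ (aux_omega_mul _ (Γ₁.add_mem w.2.1.2 (Γ₁.add_mem m1 (aux_omega_mul _ m1))))
      have m4 : ((-k : ℤ) : ℂ) + (((c w.2.2).1 - 2 * k : ℤ) : ℂ) * ω₀ ∈ Γ₁ :=
        (aux_mem _).2 ⟨(-k, (c w.2.2).1 - 2 * k), rfl⟩
      have h3 : ω₀ ^ 3 = 1 := by linear_combination (ω₀ - 1) * aux_omega_sq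
      refine ⟨(⟨_, m1⟩, ⟨_, m3⟩, ⟨_, m4⟩), ?_⟩
      obtain ⟨e1, e2, e3⟩ := hΦ (⟨_, m1⟩, ⟨_, m3⟩, ⟨_, m4⟩)
      refine Prod.ext (Subtype.ext ?_) (Prod.ext (Subtype.ext ?_) (Subtype.ext ?_))
      · rw [e1, aux_u]
        linear_combination (w.1 : ℂ) * h3
      · rw [e2, aux_u]
        linear_combination ((w.2.1 : ℂ) + w.1 * ω₀ ^ 2 + w.1 * ω₀ ^ 3) * h3
      · rw [e3, aux_exp, ← hc w.2.2]
        push_cast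
        linear_combination (-((c w.2.2).1 - 2 * k) : ℂ) * aux_omega_sq - ω₀ * hk'
  exact ⟨(QuotientAddGroup.quotientAddEquivOfEq hker).trans
    (QuotientAddGroup.quotientKerEquivOfSurjective g hsurj)⟩
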